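/- arXiv:1804.00940 — 4 statements merged into one kernel-verified Lean document; each statement's English description precedes it below -/
import Mathlib

section
/- Let A be a Noetherian ring and M a finitely generated A-module contained in a free A-module F of finite rank r > 0, with rank_A M = r. Then the total ring of fractions of the Rees algebra R(M) coincides with the total ring of fractions of the polynomial ring S = Sym_A(F). Moreover, if A is a normal domain, then the integral closure of R(M) in its total ring of fractions equals the integral closure of R(M) in S. -/
set_option maxHeartbeats 1000000
set_option synthInstance.maxHeartbeats 400000

open MvPolynomial IsLocalRing

/-- The embedding of the free module `A^r` onto the degree-one part of the
polynomial ring `Sym_A(A^r) = A[t_1, ..., t_r]`, sending `f` to `∑ i, f i • X i`. -/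
noncomputable abbrev emb (A : Type) [CommRing A] (r : ℕ) :
    (Fin r → A) →ₗ[A] MvPolynomial (Fin r) A :=
  Fintype.linearCombination A MvPolynomial.X

/-- The image `F₁` of the free module `F = A^r` inside `S = Sym_A(F)`. -/
noncomputable def freeSub (A : Type) [CommRing A] (r : ℕ) :
    Submodule A (MvPolynomial (Fin r) A) :=
  Submodule.map (emb A r) ⊤

/-- The image `M₁` of a submodule `M ⊆ F` inside `S = Sym_A(F)`. -/
noncomputable def sub1 (A : Type) [CommRing A] (r : ℕ) (M : Submodule A (Fin r → A)) :
    Submodule A (MvPolynomial (Fin r) A) :=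
  M.map (emb A r)

/-- The Rees algebra `R(M)` of `M ⊆ F`, i.e. the `A`-subalgebra of `S = Sym_A(F)`
generated by the degree-one part `M₁`; its `n`-th homogeneous component is `M₁ ^ n`. -/
noncomputable abbrev reesAlg (A : Type) [CommRing A] (r : ℕ) (M : Submodule A (Fin r → A)) :
    Subalgebra A (MvPolynomial (Fin r) A) :=
  Algebra.adjoin A (sub1 A r M : Set (MvPolynomial (Fin r) A))

/-- The Ratliff--Rush closure `⋃_{ℓ > 0} [N^{ℓ+1} :_{Fn} N^ℓ]` of `N` (inside `Fn`),
where all powers and quotients of submodules are taken inside `S = Sym_A(F)`. -/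
noncomputable def ratliffRush (A : Type) [CommRing A] (r : ℕ)
    (Fn N : Submodule A (MvPolynomial (Fin r) A)) : Submodule A (MvPolynomial (Fin r) A) :=
  ⨆ ℓ : ℕ, (Fn ⊓ (N ^ (ℓ + 2) / N ^ (ℓ + 1)))

/-- The positive part `R₊ = ker(constant term)` of a graded subalgebra `R₀ ⊆ S`. -/
noncomputable def posPart (A : Type) [CommRing A] (r : ℕ)
    (R0 : Subalgebra A (MvPolynomial (Fin r) A)) : Ideal ↥R0 :=
  RingHom.ker ((MvPolynomial.constantCoeff).comp R0.val.toRingHom)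

/-- `widetilde{R₀} = ε⁻¹(H⁰_{R₀₊}(S/R₀))`, i.e., the set of `x ∈ S` annihilated into `R₀`
by a power of the irrelevant ideal `R₀₊`; a graded subring of `S` containing `R₀`. -/
noncomputable def rrAlg (A : Type) [CommRing A] (r : ℕ)
    (R0 : Subalgebra A (MvPolynomial (Fin r) A)) : Subalgebra A (MvPolynomial (Fin r) A) where
  carrier := {x | ∃ m : ℕ, ∀ y ∈ (posPart A r R0) ^ m,
    (y : MvPolynomial (Fin r) A) * x ∈ R0}
  mul_mem' := by
    rintro x₁ x₂ ⟨m₁, h₁⟩ ⟨m₂, h₂⟩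
    refine ⟨m₁ + m₂, fun y hy => ?_⟩
    rw [pow_add] at hy
    refine Submodule.mul_induction_on hy (fun p hp q hq => ?_) (fun a b ha hb => ?_)
    · have : ((p * q : ↥R0) : MvPolynomial (Fin r) A) * (x₁ * x₂)
          = ((p : MvPolynomial (Fin r) A) * x₁) * ((q : MvPolynomial (Fin r) A) * x₂) := by
        push_cast; ring
      rw [this]
      exact mul_mem (h₁ p hp) (h₂ q hq)
    · have : ((a + b : ↥R0) : MvPolynomial (Fin r) A) * (x₁ * x₂)
          = (a : MvPolynomial (Fin r) A) * (x₁ * x₂)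
            + (b : MvPolynomial (Fin r) A) * (x₁ * x₂) := by
        push_cast; ring
      rw [this]
      exact add_mem ha hb
  one_mem' := ⟨0, fun y _ => by rw [mul_one]; exact y.2⟩
  add_mem' := by
    rintro x₁ x₂ ⟨m₁, h₁⟩ ⟨m₂, h₂⟩
    refine ⟨m₁ + m₂, fun y hy => ?_⟩
    rw [mul_add]
    exact add_mem (h₁ y (Ideal.pow_le_pow_right (Nat.le_add_right _ _) hy))
      (h₂ y (Ideal.pow_le_pow_right (Nat.le_add_left _ _) hy))
  zero_mem' := ⟨0, fun y _ => by simpa using R0.zero_mem⟩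
  algebraMap_mem' := fun a =>
    ⟨0, fun y _ => mul_mem y.2 (R0.algebraMap_mem a)⟩

/-- The integral closure of the Rees algebra `R(M)` inside `S = Sym_A(F)`,
viewed as an `A`-subalgebra of `S`. -/
noncomputable def intClAlg (A : Type) [CommRing A] (r : ℕ) (M : Submodule A (Fin r → A)) :
    Subalgebra A (MvPolynomial (Fin r) A) :=
  (integralClosure (↥(reesAlg A r M)) (MvPolynomial (Fin r) A)).restrictScalars A

/-- The integral closure `overline{M^n}`: the `n`-th homogeneous component of the
integral closure of `R(M)` in `S`. -/
noncomputable def barPow (A : Type) [CommRing A] (r : ℕ) (M : Submodule A (Fin r → A))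
    (n : ℕ) : Submodule A (MvPolynomial (Fin r) A) :=
  (freeSub A r) ^ n ⊓ (Subalgebra.toSubmodule (intClAlg A r M))

/-- `M` is a faithful `A`-module. -/
def faithfulSub (A : Type) [CommRing A] (r : ℕ) (M : Submodule A (Fin r → A)) : Prop :=
  ∀ a : A, (∀ x ∈ M, a • x = (0 : Fin r → A)) → a = 0

/-- The length of an `A`-module, as the Krull dimension of its lattice of submodules. -/
noncomputable def modLength (A : Type) [CommRing A] (N : Type) [AddCommGroup N]
    [Module A N] : WithBot ℕ∞ :=
  Order.krullDim (Submodule A N)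

/-- The quotient module `P/N` of two submodules of `S`. -/
abbrev quotNP (A : Type) [CommRing A] (r : ℕ)
    (N P : Submodule A (MvPolynomial (Fin r) A)) :=
  ↥P ⧸ (N.comap P.subtype)

/-- The minimal number of generators of a submodule. -/
noncomputable def minGen (A : Type) [CommRing A] {V : Type} [AddCommGroup V] [Module A V]
    (N : Submodule A V) : ℕ :=
  sInf {n : ℕ | ∃ f : Fin n → V, Submodule.span A (Set.range f) = N}

/-- A Noetherian local ring is Cohen--Macaulay if its depth equals its Krull dimension,
i.e. there is a regular sequence in the maximal ideal whose length is the dimension. -/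
def IsCohenMacaulayLocalRing (R : Type) [CommRing R] [IsLocalRing R] : Prop :=
  ∃ rs : List R, (∀ x ∈ rs, x ∈ maximalIdeal R) ∧
    RingTheory.Sequence.IsRegular R rs ∧ (rs.length : WithBot ℕ∞) = ringKrullDim R

/-- A Noetherian local ring is Buchsbaum (in the sense of Stückrad--Vogel) if every
system of parameters `x_1, …, x_d` is a weak sequence:
`(x_1, …, x_{i-1}) : x_i ⊆ (x_1, …, x_{i-1}) : 𝔪` for all `i`. -/
def IsBuchsbaumLocalRing (R : Type) [CommRing R] [IsLocalRing R] : Prop :=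
  ∀ d : ℕ, ringKrullDim R = d →
    ∀ x : Fin d → R, (∀ i, x i ∈ maximalIdeal R) →
      maximalIdeal R ≤ (Ideal.span (Set.range x)).radical →
      ∀ i : Fin d,
        (Ideal.span (x '' {j | j < i})).colon (Ideal.span {x i}) ≤
          (Ideal.span (x '' {j | j < i})).colon (maximalIdeal R)

/-- An ideal `P` of a graded subalgebra `R₀ ⊆ S` is graded (homogeneous) if it contains,
together with any element, all of its homogeneous components. -/
def IsGradedIdeal (A : Type) [CommRing A] (r : ℕ)
    (R0 : Subalgebra A (MvPolynomial (Fin r) A)) (P : Ideal ↥R0) : Prop :=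
  ∀ x : ↥R0, x ∈ P → ∀ n : ℕ,
    ∀ h : MvPolynomial.homogeneousComponent n (x : MvPolynomial (Fin r) A) ∈ R0,
      (⟨_, h⟩ : ↥R0) ∈ P

/-- The graded maximal ideal `𝔐 = 𝔪 R(M) + R(M)₊` of the Rees algebra, i.e. the
preimage of the maximal ideal under the degree-zero projection. -/
noncomputable abbrev gradedMax (A : Type) [CommRing A] [IsLocalRing A] (r : ℕ)
    (M : Submodule A (Fin r → A)) : Ideal ↥(reesAlg A r M) :=
  Ideal.comap ((MvPolynomial.constantCoeff).comp (reesAlg A r M).val.toRingHom)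
    (maximalIdeal A)

theorem helper_intClosed (A : Type) [CommRing A] [IsDomain A] [IsIntegrallyClosed A] (r : ℕ) :
    IsIntegrallyClosed (MvPolynomial (Fin r) A) := by
  induction r with
  | zero =>
    exact IsIntegrallyClosed.of_equiv (MvPolynomial.isEmptyRingEquiv A (Fin 0)).symm
  | succ n ih =>
    exact IsIntegrallyClosed.of_equiv (MvPolynomial.finSuccEquiv A n).symm.toRingEquiv

theorem helper_C_nzd (A : Type) [CommRing A] (r : ℕ) (a : A) (ha : a ∈ nonZeroDivisors A)
    (s : MvPolynomial (Fin r) A) (h : MvPolynomial.C a * s = 0) : s = 0 := by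
  ext m
  have h1 := congrArg (MvPolynomial.coeff m) h
  rw [MvPolynomial.coeff_C_mul, MvPolynomial.coeff_zero] at h1
  rw [MvPolynomial.coeff_zero]
  exact (mem_nonZeroDivisors_iff.1 ha).1 _ h1

theorem helper_clear (A : Type) [CommRing A] (r : ℕ) (M : Submodule A (Fin r → A))
    (hrank : ∀ f : Fin r → A, ∃ a ∈ nonZeroDivisors A, a • f ∈ M)
    (s : MvPolynomial (Fin r) A) :
    ∃ a ∈ nonZeroDivisors A, MvPolynomial.C a * s ∈ reesAlg A r M := by
  have hC : ∀ a : A, MvPolynomial.C a ∈ reesAlg A r M := fun a =>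
    (reesAlg A r M).algebraMap_mem a
  induction s using MvPolynomial.induction_on with
  | C b => exact ⟨1, one_mem _, mul_mem (hC _) (hC _)⟩
  | add p q hp hq =>
    obtain ⟨a, ha, hap⟩ := hp
    obtain ⟨b, hb, hbq⟩ := hq
    refine ⟨a * b, mul_mem ha hb, ?_⟩
    have : MvPolynomial.C (a * b) * (p + q)
        = MvPolynomial.C b * (MvPolynomial.C a * p) + MvPolynomial.C a * (MvPolynomial.C b * q) := by
      rw [MvPolynomial.C_mul]; ring
    rw [this]
    exact add_mem (mul_mem (hC _) hap) (mul_mem (hC _) hbq)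
  | mul_X p i hp =>
    obtain ⟨a, ha, hap⟩ := hp
    obtain ⟨b, hb, hbM⟩ := hrank (Pi.single i 1)
    refine ⟨a * b, mul_mem ha hb, ?_⟩
    have : MvPolynomial.C (a * b) * (p * MvPolynomial.X i)
        = (MvPolynomial.C a * p) * (MvPolynomial.C b * MvPolynomial.X i) := by
      rw [MvPolynomial.C_mul]; ring
    rw [this]
    refine mul_mem hap (Algebra.subset_adjoin ?_)
    refine ⟨_, hbM, ?_⟩
    rw [map_smul, MvPolynomial.C_mul']
    simp [emb, Fintype.linearCombination_apply_single]

theorem helper_isLoc (A : Type) [CommRing A] (r : ℕ) (M : Submodule A (Fin r → A))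
    (hrank : ∀ f : Fin r → A, ∃ a ∈ nonZeroDivisors A, a • f ∈ M) :
    letI : Algebra ↥(reesAlg A r M) (Localization (nonZeroDivisors (MvPolynomial (Fin r) A))) :=
      ((algebraMap (MvPolynomial (Fin r) A)
        (Localization (nonZeroDivisors (MvPolynomial (Fin r) A)))).comp
          (reesAlg A r M).val.toRingHom).toAlgebra
    IsLocalization (nonZeroDivisors ↥(reesAlg A r M))
      (Localization (nonZeroDivisors (MvPolynomial (Fin r) A))) := by
  letI : Algebra ↥(reesAlg A r M) (Localization (nonZeroDivisors (MvPolynomial (Fin r) A))) :=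
      ((algebraMap (MvPolynomial (Fin r) A)
        (Localization (nonZeroDivisors (MvPolynomial (Fin r) A)))).comp
          (reesAlg A r M).val.toRingHom).toAlgebra
  have hmap : ∀ x : ↥(reesAlg A r M), algebraMap ↥(reesAlg A r M)
      (Localization (nonZeroDivisors (MvPolynomial (Fin r) A))) x
      = algebraMap (MvPolynomial (Fin r) A) _ (x : MvPolynomial (Fin r) A) := fun x => rfl
  have hinj : Function.Injective (algebraMap (MvPolynomial (Fin r) A)
      (Localization (nonZeroDivisors (MvPolynomial (Fin r) A)))) :=
    IsLocalization.injective _ le_rfl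
  have hup : ∀ y : ↥(reesAlg A r M), y ∈ nonZeroDivisors ↥(reesAlg A r M) →
      (y : MvPolynomial (Fin r) A) ∈ nonZeroDivisors (MvPolynomial (Fin r) A) := by
    intro y hy
    rw [mem_nonZeroDivisors_iff_right]
    intro s hs
    obtain ⟨a, ha, has⟩ := helper_clear A r M hrank s
    apply helper_C_nzd A r a ha
    have h2 : (⟨_, has⟩ : ↥(reesAlg A r M)) * y = 0 := by
      apply Subtype.ext
      change MvPolynomial.C a * s * (y : MvPolynomial (Fin r) A) = 0
      rw [mul_assoc, hs, mul_zero]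
    exact congrArg Subtype.val ((mem_nonZeroDivisors_iff_right.1 hy) _ h2)
  have hdown : ∀ y : ↥(reesAlg A r M),
      (y : MvPolynomial (Fin r) A) ∈ nonZeroDivisors (MvPolynomial (Fin r) A) →
      y ∈ nonZeroDivisors ↥(reesAlg A r M) := by
    intro y hy
    rw [mem_nonZeroDivisors_iff_right]
    intro s hs
    apply Subtype.ext
    exact (mem_nonZeroDivisors_iff_right.1 hy) _ (congrArg Subtype.val hs)
  refine { map_units := ?_, surj := ?_, exists_of_eq := ?_ }
  · intro y
    rw [hmap]
    exact IsLocalization.map_units _ (⟨_, hup _ y.2⟩ : nonZeroDivisors (MvPolynomial (Fin r) A))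
  · intro z
    obtain ⟨⟨p, q⟩, hpq⟩ := IsLocalization.surj (nonZeroDivisors (MvPolynomial (Fin r) A)) z
    obtain ⟨a, ha, hap⟩ := helper_clear A r M hrank p
    obtain ⟨b, hb, hbq⟩ := helper_clear A r M hrank q
    have hCm : ∀ a ∈ nonZeroDivisors A, (MvPolynomial.C a : MvPolynomial (Fin r) A) ∈
        nonZeroDivisors (MvPolynomial (Fin r) A) := by
      intro a ha
      rw [mem_nonZeroDivisors_iff_right]
      intro s hs
      exact helper_C_nzd A r a ha s (by rw [mul_comm]; exact hs)
    have hC : ∀ a : A, MvPolynomial.C a ∈ reesAlg A r M := fun a =>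
      (reesAlg A r M).algebraMap_mem a
    refine ⟨(⟨_, mul_mem (hC b) hap⟩, ⟨⟨_, mul_mem (hC a) hbq⟩, hdown _ ?_⟩), ?_⟩
    · exact mul_mem (hCm a ha) (mul_mem (hCm b hb) q.2)
    · rw [hmap, hmap]
      simp only [map_mul] at hpq ⊢
      rw [← hpq]
      ring
  · intro x y hxy
    rw [hmap, hmap] at hxy
    exact ⟨1, by rw [Subtype.ext (hinj hxy)]⟩

/-- Lemma 2.3. Let `A` be a Noetherian ring and `M` a finitely generated
`A`-module contained in a free module `F` of finite rank `r > 0`, with `rank_A M = r`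
(i.e. `F/M` is a torsion module). Then the total ring of fractions of the Rees algebra
`R(M)` coincides with the total ring of fractions of `S = Sym_A(F)` (the canonical
inclusion `R(M) → S → Q(S)` identifies `Q(R(M))` with `Q(S)`). Moreover, if `A` is a
normal domain, then the integral closure of `R(M)` in its total ring of fractions equals
the integral closure of `R(M)` in `S`. -/
theorem ratliffRush_statement_0 (A : Type) [CommRing A] [IsNoetherianRing A]
    (r : ℕ) (hr : 0 < r) (M : Submodule A (Fin r → A))
    (hrank : ∀ f : Fin r → A, ∃ a ∈ nonZeroDivisors A, a • f ∈ M) :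
    (∃ e : Localization (nonZeroDivisors ↥(reesAlg A r M)) ≃+*
        Localization (nonZeroDivisors (MvPolynomial (Fin r) A)),
      ∀ x : ↥(reesAlg A r M),
        e (algebraMap ↥(reesAlg A r M)
            (Localization (nonZeroDivisors ↥(reesAlg A r M))) x)
          = algebraMap (MvPolynomial (Fin r) A)
              (Localization (nonZeroDivisors (MvPolynomial (Fin r) A)))
              (x : MvPolynomial (Fin r) A)) ∧
    (∀ (_ : IsDomain A) (_ : IsIntegrallyClosed A),
      ∀ x : Localization (nonZeroDivisors (MvPolynomial (Fin r) A)),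
        RingHom.IsIntegralElem
          ((algebraMap (MvPolynomial (Fin r) A)
              (Localization (nonZeroDivisors (MvPolynomial (Fin r) A)))).comp
            (reesAlg A r M).val.toRingHom) x
        ↔ ∃ y ∈ intClAlg A r M,
            algebraMap (MvPolynomial (Fin r) A)
              (Localization (nonZeroDivisors (MvPolynomial (Fin r) A))) y = x) := by
  refine ⟨?_, ?_⟩
  · letI : Algebra ↥(reesAlg A r M) (Localization (nonZeroDivisors (MvPolynomial (Fin r) A))) :=
      ((algebraMap (MvPolynomial (Fin r) A)
        (Localization (nonZeroDivisors (MvPolynomial (Fin r) A)))).comp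
          (reesAlg A r M).val.toRingHom).toAlgebra
    haveI := helper_isLoc A r M hrank
    refine ⟨(IsLocalization.algEquiv (nonZeroDivisors ↥(reesAlg A r M))
      (Localization (nonZeroDivisors ↥(reesAlg A r M)))
      (Localization (nonZeroDivisors (MvPolynomial (Fin r) A)))).toRingEquiv, fun x => ?_⟩
    exact AlgEquiv.commutes (IsLocalization.algEquiv (nonZeroDivisors ↥(reesAlg A r M))
      (Localization (nonZeroDivisors ↥(reesAlg A r M)))
      (Localization (nonZeroDivisors (MvPolynomial (Fin r) A)))) x
  · intro hD hI x
    haveI := helper_intClosed A r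
    have hinj : Function.Injective (algebraMap (MvPolynomial (Fin r) A)
        (Localization (nonZeroDivisors (MvPolynomial (Fin r) A)))) :=
      IsLocalization.injective _ le_rfl
    constructor
    · intro hx
      have hS : IsIntegral (MvPolynomial (Fin r) A) x := RingHom.IsIntegralElem.of_comp hx
      obtain ⟨y, rfl⟩ := IsIntegrallyClosed.isIntegral_iff.1 hS
      exact ⟨y, RingHom.IsIntegralElem.of_map hinj hx, rfl⟩
    · rintro ⟨y, hy, rfl⟩
      exact RingHom.IsIntegralElem.map (f := (reesAlg A r M).val.toRingHom) hy _
end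

section
/- Let A be a normal Noetherian domain and M an ideal module (a nonzero finitely generated torsion-free A-module whose double dual M** is free). If M is embedded into a finite free A-module G of positive rank, then the integral closure of R(M) in S = Sym_A(M**) is isomorphic to the integral closure of R(M) in T = Sym_A(G). In particular, up to isomorphism, the integral closure of the Rees algebra does not depend on the choice of the embedding of M into a finite free module. -/
set_option maxHeartbeats 1000000
set_option synthInstance.maxHeartbeats 400000

open MvPolynomial IsLocalRing

/-- The Rees algebra of an abstract module `M` with respect to an embedding
`ι : M → A^k` into a finite free module: the subalgebra of `Sym_A(A^k)` generated by
the image of `M` in degree one. -/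
noncomputable abbrev reesOf (A : Type) [CommRing A] (M : Type) [AddCommGroup M]
    [Module A M] (k : ℕ) (ι : M →ₗ[A] (Fin k → A)) :
    Subalgebra A (MvPolynomial (Fin k) A) :=
  Algebra.adjoin A
    ((Submodule.map ((emb A k) ∘ₗ ι) ⊤ : Submodule A (MvPolynomial (Fin k) A)) :
      Set (MvPolynomial (Fin k) A))

/-- The integral closure of the Rees algebra `R(M)` (w.r.t. the embedding `ι`) inside
the polynomial ring `Sym_A(A^k)`, as an `A`-subalgebra. -/
noncomputable abbrev intClOf (A : Type) [CommRing A] (M : Type) [AddCommGroup M]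
    [Module A M] (k : ℕ) (ι : M →ₗ[A] (Fin k → A)) :
    Subalgebra A (MvPolynomial (Fin k) A) :=
  (integralClosure (↥(reesOf A M k ι)) (MvPolynomial (Fin k) A)).restrictScalars A

theorem aux_square {R S R2 S2 : Type*} [CommRing R] [CommRing S] [CommRing R2] [CommRing S2]
    (f : R →+* S) (f2 : R2 →+* S2) (u : R →+* R2) (v : S →+* S2)
    (h : ∀ x, v (f x) = f2 (u x)) {x : S} (hx : f.IsIntegralElem x) :
    f2.IsIntegralElem (v x) := by
  obtain ⟨p, hp, hpx⟩ := hx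
  refine ⟨p.map u, hp.map u, ?_⟩
  have h' : f2.comp u = v.comp f := by ext x; simp [h]
  rw [Polynomial.eval₂_map, h', ← Polynomial.hom_eval₂, hpx, map_zero]

theorem aux_const {B T : Type*} [CommRing B] [CommRing T] [IsDomain T] (j : B →+* T)
    (t : Polynomial T)
    (ht : ((Polynomial.C : T →+* Polynomial T).comp j).IsIntegralElem t) :
    t.natDegree = 0 := by
  obtain ⟨q, hq, hqt⟩ := ht
  rw [← Polynomial.eval₂_map] at hqt
  have h1 : (q.map j).comp t = 0 := hqt
  have h2 := Polynomial.natDegree_comp (p := q.map j) (q := t)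
  rw [h1, Polynomial.natDegree_zero, eq_comm, mul_eq_zero] at h2
  rcases h2 with h2 | h2
  · have h3 := (hq.map j).natDegree_eq_zero.mp h2
    rw [h3] at h1
    simp at h1
  · exact h2

/-- The algebra map of polynomial rings induced by a linear map of free modules. -/
noncomputable def linAlg (A : Type) [CommRing A] {r g : ℕ}
    (c : (Fin r → A) →ₗ[A] (Fin g → A)) :
    MvPolynomial (Fin r) A →ₐ[A] MvPolynomial (Fin g) A :=
  MvPolynomial.aeval (fun i => emb A g (c (Pi.single i 1)))

theorem emb_single (A : Type) [CommRing A] {r : ℕ} (i : Fin r) :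
    emb A r (Pi.single i 1) = MvPolynomial.X i := by
  simp [emb, Fintype.linearCombination_apply_single]

theorem linAlg_emb (A : Type) [CommRing A] {r g : ℕ}
    (c : (Fin r → A) →ₗ[A] (Fin g → A)) (v : Fin r → A) :
    linAlg A c (emb A r v) = emb A g (c v) := by
  have : (linAlg A c).toLinearMap ∘ₗ emb A r = emb A g ∘ₗ c := by
    apply LinearMap.pi_ext'
    intro i
    apply LinearMap.ext_ring
    change linAlg A c (emb A r (Pi.single i 1)) = emb A g (c (Pi.single i 1))
    rw [emb_single]
    simp [linAlg]
  exact LinearMap.congr_fun this v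

theorem linAlg_leftInv (K : Type) [CommRing K] {r g : ℕ}
    (c : (Fin r → K) →ₗ[K] (Fin g → K)) (d : (Fin g → K) →ₗ[K] (Fin r → K))
    (h : d ∘ₗ c = LinearMap.id) (x : MvPolynomial (Fin r) K) :
    linAlg K d (linAlg K c x) = x := by
  have : (linAlg K d).comp (linAlg K c) = AlgHom.id K _ := by
    apply MvPolynomial.algHom_ext
    intro i
    have h2 : d (c (Pi.single i 1)) = Pi.single i 1 := LinearMap.congr_fun h _
    simp only [AlgHom.comp_apply, AlgHom.id_apply]
    rw [← emb_single, linAlg_emb, linAlg_emb, h2]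
  exact DFunLike.congr_fun this x

/-- A polynomial integral over the subring of polynomials in a direct summand of
the linear forms lies in that subring. -/
theorem aux_field (K : Type) [Field K] {r g : ℕ}
    (c : (Fin r → K) →ₗ[K] (Fin g → K)) (d : (Fin g → K) →ₗ[K] (Fin r → K))
    (h : d ∘ₗ c = LinearMap.id) (t : MvPolynomial (Fin g) K)
    (ht : (linAlg K c).toRingHom.IsIntegralElem t) :
    linAlg K c (linAlg K d t) = t := by
  let T := MvPolynomial (Fin g) K
  let H : T →ₐ[K] Polynomial T := MvPolynomial.aeval (fun j =>
    Polynomial.C (MvPolynomial.X j) * Polynomial.X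
      + Polynomial.C (linAlg K c (linAlg K d (MvPolynomial.X j))) * (1 - Polynomial.X))
  have HX : ∀ j, H (MvPolynomial.X j) = Polynomial.C (MvPolynomial.X j) * Polynomial.X
      + Polynomial.C (linAlg K c (linAlg K d (MvPolynomial.X j))) * (1 - Polynomial.X) :=
    fun j => MvPolynomial.aeval_X _ j
  have H1 : ∀ w, H (emb K g w) = Polynomial.C (emb K g w) * Polynomial.X
      + Polynomial.C (linAlg K c (linAlg K d (emb K g w))) * (1 - Polynomial.X) := by
    intro w
    have : H.toLinearMap ∘ₗ emb K g =
        (LinearMap.mulRight K (Polynomial.X : Polynomial T)) ∘ₗ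
          (Polynomial.CAlgHom (R := K) (A := T)).toLinearMap ∘ₗ emb K g +
        (LinearMap.mulRight K (1 - Polynomial.X : Polynomial T)) ∘ₗ
          (Polynomial.CAlgHom (R := K) (A := T)).toLinearMap ∘ₗ
          ((linAlg K c).comp (linAlg K d)).toLinearMap ∘ₗ emb K g := by
      apply LinearMap.pi_ext'
      intro i
      apply LinearMap.ext_ring
      change H (emb K g (Pi.single i 1)) = Polynomial.C (emb K g (Pi.single i 1)) * Polynomial.X
        + Polynomial.C (linAlg K c (linAlg K d (emb K g (Pi.single i 1)))) * (1 - Polynomial.X)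
      rw [emb_single]
      exact HX i
    exact LinearMap.congr_fun this w
  have H2 : ∀ x, H (linAlg K c x) = Polynomial.C (linAlg K c x) := by
    intro x
    have : H.comp (linAlg K c) = (Polynomial.CAlgHom (R := K) (A := T)).comp (linAlg K c) := by
      apply MvPolynomial.algHom_ext
      intro i
      change H (linAlg K c (MvPolynomial.X i)) = Polynomial.C (linAlg K c (MvPolynomial.X i))
      rw [← emb_single, linAlg_emb, H1, ← linAlg_emb, linAlg_leftInv K c d h]
      ring
    exact DFunLike.congr_fun this x
  have H3 : (H t).natDegree = 0 := by
    apply aux_const (linAlg K c).toRingHom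
    exact aux_square (linAlg K c).toRingHom _ (RingHom.id _) H.toRingHom (fun x => H2 x) ht
  have E1 : ∀ x, (H x).eval 1 = x := by
    intro x
    have : (Polynomial.evalRingHom (1 : T)).comp H.toRingHom = RingHom.id _ := by
      apply MvPolynomial.ringHom_ext
      · intro a
        have : H (MvPolynomial.C a) = algebraMap K _ a := H.commutes a
        change (H (MvPolynomial.C a)).eval 1 = _
        rw [this, IsScalarTower.algebraMap_apply K T (Polynomial T)]
        simp [T, MvPolynomial.algebraMap_eq]
      · intro i
        change (H (MvPolynomial.X i)).eval 1 = MvPolynomial.X i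
        rw [HX]
        simp
    exact DFunLike.congr_fun this x
  have E0 : ∀ x, (H x).eval 0 = linAlg K c (linAlg K d x) := by
    intro x
    have : (Polynomial.evalRingHom (0 : T)).comp H.toRingHom =
        ((linAlg K c).comp (linAlg K d)).toRingHom := by
      apply MvPolynomial.ringHom_ext
      · intro a
        have : H (MvPolynomial.C a) = algebraMap K _ a := H.commutes a
        change (H (MvPolynomial.C a)).eval 0 = ((linAlg K c).comp (linAlg K d)) (algebraMap K _ a)
        rw [this, IsScalarTower.algebraMap_apply K T (Polynomial T), AlgHom.commutes]
        simp [T, MvPolynomial.algebraMap_eq]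
      · intro i
        change (H (MvPolynomial.X i)).eval 0 = linAlg K c (linAlg K d (MvPolynomial.X i))
        rw [HX]
        simp
    exact DFunLike.congr_fun this x
  rw [← E0]
  conv_rhs => rw [← E1 t]
  rw [Polynomial.eq_C_of_natDegree_eq_zero H3]
  simp

theorem aux_ext (A : Type) [CommRing A] (K : Type) [Field K] [Algebra A K] [IsDomain A]
    [IsFractionRing A K]
    {r g : ℕ} (c : (Fin r → A) →ₗ[A] (Fin g → A)) (hc : Function.Injective c) :
    ∃ (cK : (Fin r → K) →ₗ[K] (Fin g → K)) (d : (Fin g → K) →ₗ[K] (Fin r → K)),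
      d ∘ₗ cK = LinearMap.id ∧
      ∀ x, linAlg K cK (MvPolynomial.map (algebraMap A K) x) =
        MvPolynomial.map (algebraMap A K) (linAlg A c x) := by
  let Mx := LinearMap.toMatrix' c
  let cK := Matrix.toLin' (Mx.map (algebraMap A K))
  have hcK : ∀ v : Fin r → A, cK (fun i => algebraMap A K (v i)) =
      fun j => algebraMap A K (c v j) := by
    intro v
    have : c v = Mx.mulVec v := by
      rw [← Matrix.toLin'_apply, Matrix.toLin'_toMatrix']
    rw [this]
    funext j
    simp [cK, Matrix.mulVec, dotProduct]
  have hinj : Function.Injective cK := by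
    rw [injective_iff_map_eq_zero]
    intro w hw
    obtain ⟨a, ha⟩ := IsLocalization.exist_integer_multiples_of_finite (nonZeroDivisors A) w
    choose v hv using ha
    have hv' : (fun i => algebraMap A K (v i)) = (algebraMap A K a) • w := by
      funext i
      simp [hv, Algebra.smul_def]
    have h0 : c v = 0 := by
      funext j
      apply IsFractionRing.injective A K
      have := congrFun (hcK v) j
      rw [← this, hv', map_smul, hw]
      simp
    have h1 : v = 0 := hc (by rw [h0, map_zero])
    rw [h1] at hv'
    have h2 : (algebraMap A K a) • w = 0 := by
      rw [← hv']; funext i; simp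
    rcases smul_eq_zero.mp h2 with h3 | h3
    · exact absurd ((IsFractionRing.injective A K) (h3.trans (map_zero _).symm))
        (nonZeroDivisors.ne_zero a.2)
    · exact h3
  obtain ⟨d, hd⟩ := cK.exists_leftInverse_of_injective (LinearMap.ker_eq_bot.mpr hinj)
  refine ⟨cK, d, hd, ?_⟩
  have hemb : ∀ w : Fin g → A, emb K g (fun j => algebraMap A K (w j)) =
      MvPolynomial.map (algebraMap A K) (emb A g w) := by
    intro w
    simp only [emb, Fintype.linearCombination_apply, MvPolynomial.smul_eq_C_mul, map_sum,
      map_mul, MvPolynomial.map_C, MvPolynomial.map_X]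
  intro x
  have : (linAlg K cK).toRingHom.comp (MvPolynomial.map (algebraMap A K)) =
      (MvPolynomial.map (algebraMap A K)).comp (linAlg A c).toRingHom := by
    apply MvPolynomial.ringHom_ext
    · intro a
      simp [linAlg]
    · intro i
      have h1 := hcK (Pi.single i 1)
      have h2 : (fun k => algebraMap A K ((Pi.single i 1 : Fin r → A) k)) = Pi.single i 1 := by
        funext k
        by_cases hk : k = i
        · subst hk; simp
        · simp [hk]
      rw [h2] at h1
      have h3 := hemb (c (Pi.single i 1))
      rw [← h1] at h3
      simpa [linAlg] using h3
  exact DFunLike.congr_fun this x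

theorem aux_normal (A : Type) [CommRing A] (K : Type) [Field K] [Algebra A K] [IsDomain A]
    [IsFractionRing A K] [IsIntegrallyClosed A] {r : ℕ} (u : MvPolynomial (Fin r) K)
    (hu : (MvPolynomial.map (σ := Fin r) (algebraMap A K)).IsIntegralElem u) :
    ∃ s, MvPolynomial.map (algebraMap A K) s = u := by
  letI : Algebra (MvPolynomial (Fin r) A) (MvPolynomial (Fin r) K) :=
    MvPolynomial.algebraMvPolynomial
  have h1 : IsIntegral (MvPolynomial (Fin r) A) u := hu
  rw [MvPolynomial.isIntegral_iff_isIntegral_coeff] at h1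
  have : u ∈ Set.range (MvPolynomial.map (σ := Fin r) (algebraMap A K)) := by
    rw [MvPolynomial.mem_range_map_iff_coeffs_subset]
    intro x hx
    rw [Finset.mem_coe, MvPolynomial.mem_coeffs_iff] at hx
    obtain ⟨n, -, rfl⟩ := hx
    exact IsIntegrallyClosed.isIntegral_iff.mp (h1 n)
  exact this

theorem aux_lift (A : Type) [CommRing A] (K : Type) [Field K] [Algebra A K] [IsDomain A]
    [IsFractionRing A K] [IsIntegrallyClosed A] {r g : ℕ}
    (c : (Fin r → A) →ₗ[A] (Fin g → A)) (hc : Function.Injective c) :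
    Function.Injective (linAlg A c) ∧ ∀ t, (linAlg A c).toRingHom.IsIntegralElem t →
      ∃ s, linAlg A c s = t := by
  obtain ⟨cK, d, hd, hcomm⟩ := aux_ext A K c hc
  have hmapinj : ∀ n, Function.Injective (MvPolynomial.map (σ := Fin n) (algebraMap A K)) :=
    fun n => MvPolynomial.map_injective _ (IsFractionRing.injective A K)
  refine ⟨?_, ?_⟩
  · intro x y hxy
    apply hmapinj
    rw [← linAlg_leftInv K cK d hd (MvPolynomial.map (algebraMap A K) x),
      ← linAlg_leftInv K cK d hd (MvPolynomial.map (algebraMap A K) y), hcomm, hcomm, hxy]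
  · intro t ht
    have hK : linAlg K cK (linAlg K d (MvPolynomial.map (algebraMap A K) t)) =
        MvPolynomial.map (algebraMap A K) t := by
      apply aux_field K cK d hd
      exact aux_square _ _ (MvPolynomial.map (algebraMap A K))
        (MvPolynomial.map (algebraMap A K)) (fun x => (hcomm x).symm) ht
    obtain ⟨s, hs⟩ := aux_normal A K (linAlg K d (MvPolynomial.map (algebraMap A K) t)) (by
      refine aux_square _ _ (RingHom.id _)
        ((linAlg K d).toRingHom.comp (MvPolynomial.map (algebraMap A K))) ?_ ht
      intro x
      change linAlg K d (MvPolynomial.map (algebraMap A K) (linAlg A c x)) =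
        MvPolynomial.map (algebraMap A K) x
      rw [← hcomm, linAlg_leftInv K cK d hd])
    rw [← hs, hcomm] at hK
    exact ⟨s, hmapinj g hK⟩

theorem aux_sub {A S T : Type} [CommRing A] [CommRing S] [CommRing T] [Algebra A S] [Algebra A T]
    (f : S →ₐ[A] T) (hf : Function.Injective f)
    (hT : ∀ t, f.toRingHom.IsIntegralElem t → ∃ s, f s = t)
    (R : Subalgebra A S) (R' : Subalgebra A T) (hR : R.map f = R') :
    Nonempty (↥((integralClosure R S).restrictScalars A) ≃ₐ[A]
      ↥((integralClosure R' T).restrictScalars A)) := by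
  subst hR
  let e : R ≃ₐ[A] R.map f := R.equivMapOfInjective f hf
  have he : ∀ x, ((e x : R.map f) : T) = f x := fun x => rfl
  have hes : ∀ x : R.map f, f (e.symm x) = x := by
    intro x
    rw [← he, e.apply_symm_apply]
  have hmap : ((integralClosure R S).restrictScalars A).map f =
      (integralClosure (R.map f) T).restrictScalars A := by
    ext t
    constructor
    · rintro ⟨s, hs, rfl⟩
      have hs' : (algebraMap R S).IsIntegralElem s := hs
      have := aux_square (algebraMap R S) (algebraMap (R.map f) T) (e : R →+* R.map f)
        (f : S →+* T) (fun x => (he x).symm) hs'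
      exact this
    · intro ht
      have ht' : (algebraMap (R.map f) T).IsIntegralElem t := ht
      obtain ⟨s, hst⟩ := hT t (aux_square (algebraMap (R.map f) T) f.toRingHom
        ((algebraMap R S).comp (e.symm : R.map f →+* R)) (RingHom.id T)
        (fun x => (hes x).symm) ht')
      refine ⟨s, ?_, hst⟩
      change (algebraMap R S).IsIntegralElem s
      obtain ⟨p, hp, hpt⟩ := ht'
      refine ⟨p.map (e.symm : R.map f →+* R), hp.map _, ?_⟩
      apply hf
      rw [map_zero, ← hpt, Polynomial.eval₂_map, ← hst]
      change f.toRingHom _ = _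
      rw [Polynomial.hom_eval₂]
      congr 1
      ext1 x
      exact hes x
  exact ⟨(((integralClosure R S).restrictScalars A).equivMapOfInjective f hf).trans
    (Subalgebra.equivOfEq _ _ hmap)⟩

theorem aux_main (A : Type) [CommRing A] [IsDomain A] [IsIntegrallyClosed A]
    (M : Type) [AddCommGroup M] [Module A M] (r g : ℕ)
    (ι : M →ₗ[A] (Fin r → A)) (ψ : M →ₗ[A] (Fin g → A))
    (c : (Fin r → A) →ₗ[A] (Fin g → A)) (hc : Function.Injective c)
    (hcι : ∀ m, c (ι m) = ψ m) :
    Nonempty (↥(intClOf A M r ι) ≃ₐ[A] ↥(intClOf A M g ψ)) := by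
  obtain ⟨hinj, hlift⟩ := aux_lift A (FractionRing A) c hc
  refine aux_sub (linAlg A c) hinj hlift (reesOf A M r ι) (reesOf A M g ψ) ?_
  rw [reesOf, AlgHom.map_adjoin]
  congr 1
  ext x
  constructor
  · rintro ⟨_, ⟨m, -, rfl⟩, rfl⟩
    refine ⟨m, trivial, ?_⟩
    change emb A g (ψ m) = linAlg A c (emb A r (ι m))
    rw [linAlg_emb, hcι]
  · rintro ⟨m, -, rfl⟩
    refine ⟨_, ⟨m, trivial, rfl⟩, ?_⟩
    change linAlg A c (emb A r (ι m)) = emb A g (ψ m)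
    rw [linAlg_emb, hcι]

theorem aux_dual (A : Type) [CommRing A] [IsDomain A]
    (M : Type) [AddCommGroup M] [Module A M] (g : ℕ)
    (ψ : M →ₗ[A] (Fin g → A)) (hψ : Function.Injective ψ) (f : Module.Dual A M) :
    ∃ (a : A) (w : Fin g → A), a ≠ 0 ∧ ∀ m, a * f m = ∑ j, w j * ψ m j := by
  let K := FractionRing A
  have h1 : Function.Injective (ψ.baseChange K) :=
    Module.Flat.lTensor_preserves_injective_linearMap (M := K) ψ hψ
  obtain ⟨σ, hσ⟩ := (ψ.baseChange K).exists_leftInverse_of_injective (LinearMap.ker_eq_bot.mpr h1)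
  let G : (Fin g → A) → K := fun v =>
    Module.Dual.baseChange K f (σ (TensorProduct.tmul A 1 v))
  have G1 : ∀ m, G (ψ m) = algebraMap A K (f m) := by
    intro m
    have : σ (TensorProduct.tmul A (1 : K) (ψ m)) = TensorProduct.tmul A (1 : K) m := by
      have := LinearMap.congr_fun hσ (TensorProduct.tmul A (1 : K) m)
      simpa using this
    simp [G, this, Algebra.smul_def]
  have G2 : ∀ v, G v = ∑ j, algebraMap A K (v j) * G (Pi.single j 1) := by
    intro v
    conv_lhs => rw [pi_eq_sum_univ' v]
    simp only [G, TensorProduct.tmul_sum, map_sum]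
    refine Finset.sum_congr rfl fun j _ => ?_
    have : (fun i => if j = i then (1 : A) else 0) = Pi.single j 1 := by
      funext i; simp [Pi.single_apply, eq_comm]
    rw [TensorProduct.tmul_smul, ← algebraMap_smul K (v j), map_smul, map_smul,
      smul_eq_mul]
  obtain ⟨a, ha⟩ := IsLocalization.exist_integer_multiples_of_finite (nonZeroDivisors A)
    (fun j : Fin g => G (Pi.single j 1))
  choose w hw using ha
  refine ⟨a, w, nonZeroDivisors.ne_zero a.2, fun m => ?_⟩
  apply IsFractionRing.injective A K
  rw [map_mul, ← G1, G2, map_sum, Finset.mul_sum]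
  refine Finset.sum_congr rfl fun j _ => ?_
  rw [map_mul, hw j, Algebra.smul_def]
  ring

/-- Proposition 2.4. Let `A` be a normal Noetherian domain and `M` an
ideal module: a nonzero finitely generated torsion-free `A`-module whose double dual
`M** ≃ A^r` (`r > 0`) is free, into which `M` embeds canonically via the biduality map.
If `M` is also embedded into a finite free module `G = A^g` of positive rank via `ψ`, then
the integral closure of `R(M)` in `S = Sym_A(M**)` is isomorphic (as an `A`-algebra) to
the integral closure of `R(M)` in `T = Sym_A(G)`; in particular, up to isomorphism, the
integral closure of the Rees algebra does not depend on the choice of embedding. -/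
theorem ratliffRush_statement_1 (A : Type) [CommRing A] [IsDomain A]
    [IsIntegrallyClosed A] [IsNoetherianRing A]
    (M : Type) [AddCommGroup M] [Module A M] [Module.Finite A M]
    [Nontrivial M] [NoZeroSMulDivisors A M]
    (r : ℕ) (hr : 0 < r)
    (b : Module.Dual A (Module.Dual A M) ≃ₗ[A] (Fin r → A))
    (g : ℕ) (hg : 0 < g)
    (ψ : M →ₗ[A] (Fin g → A)) (hψ : Function.Injective ψ) :
    Nonempty
      (↥(intClOf A M r (b.toLinearMap ∘ₗ Module.Dual.eval A M))
        ≃ₐ[A] ↥(intClOf A M g ψ)) := by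
  let c : (Fin r → A) →ₗ[A] (Fin g → A) :=
    LinearMap.pi (fun j => (LinearMap.applyₗ (LinearMap.proj j ∘ₗ ψ : Module.Dual A M)) ∘ₗ
      b.symm.toLinearMap)
  have hcv : ∀ v j, c v j = b.symm v (LinearMap.proj j ∘ₗ ψ) := fun v j => rfl
  refine aux_main A M r g _ ψ c ?_ ?_
  · rw [injective_iff_map_eq_zero]
    intro v hv
    have h0 : b.symm v = 0 := by
      apply LinearMap.ext
      intro f
      obtain ⟨a, w, ha, haw⟩ := aux_dual A M g ψ hψ f
      have h1 : a • f = ∑ j, w j • (LinearMap.proj j ∘ₗ ψ : Module.Dual A M) := by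
        apply LinearMap.ext
        intro m
        simp [haw]
      have h2 : a • b.symm v f = 0 := by
        rw [← map_smul, h1, map_sum]
        refine Finset.sum_eq_zero fun j _ => ?_
        rw [map_smul, ← hcv, hv]
        simp
      rcases smul_eq_zero.mp h2 with h3 | h3
      · exact absurd h3 ha
      · exact h3
    simpa using h0
  · intro m
    funext j
    rw [hcv]
    simp
end

section
/- Let A be a Noetherian ring and M a finitely generated A-module contained in a free A-module F of finite rank r > 0. For every integer n ≥ 0, the Ratliff–Rush closure of M^n satisfies tilde(M^n) = ⋃_{ℓ>0} [(M^n)^{ℓ+1} :_{F^n} (M^n)^ℓ] = (widetilde((MS)^n))_n, where widetilde((MS)^n) is the ordinary Ratliff–Rush closure of the ideal (MS)^n of S. In particular tilde(M) = ⋃_{ℓ>0} [M^{ℓ+1} :_F M^ℓ] = (widetilde(MS))_1. -/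
set_option maxHeartbeats 1000000
set_option synthInstance.maxHeartbeats 400000

open MvPolynomial IsLocalRing

section helpers

variable {A : Type} [CommRing A] {r : ℕ}

theorem sub1_le_freeSub (M : Submodule A (Fin r → A)) : sub1 A r M ≤ freeSub A r :=
  Submodule.map_mono le_top

theorem freeSub_le : freeSub A r ≤ homogeneousSubmodule (Fin r) A 1 := by
  rintro _ ⟨f, -, rfl⟩
  rw [Fintype.linearCombination_apply]
  exact Submodule.sum_mem _ fun i _ => Submodule.smul_mem _ _ (isHomogeneous_X A i)

theorem freeSub_pow_le (k : ℕ) : (freeSub A r) ^ k ≤ homogeneousSubmodule (Fin r) A k := by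
  induction k with
  | zero =>
    rw [pow_zero, Submodule.one_le]
    exact isHomogeneous_one _ _
  | succ k ih =>
    rw [pow_succ, Submodule.mul_le]
    intro a ha b hb
    exact IsHomogeneous.mul (ih ha) (freeSub_le hb)

theorem sub1_pow_le (M : Submodule A (Fin r → A)) (k : ℕ) :
    (sub1 A r M) ^ k ≤ homogeneousSubmodule (Fin r) A k :=
  (pow_le_pow_left' (sub1_le_freeSub M) k).trans (freeSub_pow_le k)

theorem comp_mul (a w : MvPolynomial (Fin r) A) (k : ℕ)
    (hw : w ∈ homogeneousSubmodule (Fin r) A k) :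
    homogeneousComponent k (a * w) = constantCoeff a • w := by
  conv_lhs => rw [← sum_homogeneousComponent a, Finset.sum_mul, map_sum]
  rw [Finset.sum_eq_single 0]
  · rw [homogeneousComponent_zero, homogeneousComponent_C_mul,
      homogeneousComponent_eq_self hw, smul_eq_C_mul, constantCoeff_eq]
  · intro i _ hi
    have : homogeneousComponent i a * w ∈ homogeneousSubmodule (Fin r) A (i + k) :=
      IsHomogeneous.mul (homogeneousComponent_isHomogeneous i a) hw
    rw [homogeneousComponent_of_mem this, if_neg (by omega)]
  · intro h
    simp at h

theorem span_pow_eq (P : Submodule A (MvPolynomial (Fin r) A)) (k : ℕ) :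
    (Ideal.span (P : Set (MvPolynomial (Fin r) A))) ^ k
      = Ideal.span ((P ^ k : Submodule A (MvPolynomial (Fin r) A)) :
          Set (MvPolynomial (Fin r) A)) := by
  induction k with
  | zero =>
    rw [pow_zero, pow_zero, Ideal.one_eq_top, eq_comm, Ideal.eq_top_iff_one]
    exact Ideal.subset_span (Submodule.one_le.mp le_rfl)
  | succ k ih =>
    rw [pow_succ, ih, Ideal.span_mul_span', pow_succ]
    apply le_antisymm
    · apply Ideal.span_mono
      rintro _ ⟨a, ha, b, hb, rfl⟩
      exact Submodule.mul_mem_mul ha hb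
    · rw [Ideal.span_le]
      intro x hx
      refine Submodule.mul_induction_on hx (fun a ha b hb => ?_) (fun a b ha hb => ?_)
      · exact Ideal.subset_span ⟨a, ha, b, hb, rfl⟩
      · exact add_mem ha hb

theorem mem_pow_of_mem_span (M : Submodule A (Fin r → A)) (k : ℕ) (x : MvPolynomial (Fin r) A)
    (hx : x ∈ homogeneousSubmodule (Fin r) A k)
    (h : x ∈ Ideal.span ((sub1 A r M ^ k : Submodule A (MvPolynomial (Fin r) A)) :
          Set (MvPolynomial (Fin r) A))) : x ∈ sub1 A r M ^ k := by
  have key : ∀ z ∈ Ideal.span ((sub1 A r M ^ k : Submodule A (MvPolynomial (Fin r) A)) :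
          Set (MvPolynomial (Fin r) A)), homogeneousComponent k z ∈ sub1 A r M ^ k := by
    intro z hz
    induction hz using Submodule.span_induction with
    | mem w hw =>
      rw [homogeneousComponent_eq_self (sub1_pow_le M k hw)]
      exact hw
    | zero => simp
    | add a b _ _ ha hb => rw [map_add]; exact add_mem ha hb
    | smul a w hw hh =>
      clear hx h hh
      induction hw using Submodule.span_induction generalizing a with
      | mem w hw =>
        rw [smul_eq_mul, comp_mul a w k (sub1_pow_le M k hw)]
        exact Submodule.smul_mem _ _ hw
      | zero => simp
      | add u v _ _ hu hv =>
        rw [smul_add, map_add]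
        exact add_mem (hu a) (hv a)
      | smul b w _ hw =>
        rw [smul_smul]
        exact hw _
  have := key x h
  rwa [homogeneousComponent_eq_self hx] at this

theorem adjoin_le_iSup (P : Submodule A (MvPolynomial (Fin r) A)) (z : MvPolynomial (Fin r) A)
    (hz : z ∈ Algebra.adjoin A (P : Set (MvPolynomial (Fin r) A))) : z ∈ ⨆ k : ℕ, P ^ k := by
  induction hz using Algebra.adjoin_induction with
  | mem x hx => exact Submodule.mem_iSup_of_mem 1 (by rwa [pow_one])
  | algebraMap a =>
    exact Submodule.mem_iSup_of_mem 0 (by rw [pow_zero]; exact Submodule.algebraMap_mem a)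
  | add x y _ _ hx hy => exact add_mem hx hy
  | mul x y _ _ hx hy =>
    have h := Submodule.mul_mem_mul hx hy
    rw [Submodule.iSup_mul] at h
    simp_rw [Submodule.mul_iSup, ← pow_add] at h
    have hle : (⨆ i : ℕ, ⨆ j : ℕ, P ^ (i + j)) ≤ ⨆ k : ℕ, P ^ k :=
      iSup_le fun i => iSup_le fun j => le_iSup (fun k => P ^ k) (i + j)
    refine hle ?_
    exact h

theorem pow_le_adjoin (P : Submodule A (MvPolynomial (Fin r) A)) (k : ℕ) :
    P ^ k ≤ Subalgebra.toSubmodule (Algebra.adjoin A (P : Set (MvPolynomial (Fin r) A))) := by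
  induction k with
  | zero => rw [pow_zero, Submodule.one_le]; exact Subalgebra.one_mem _
  | succ k ih =>
    rw [pow_succ, Submodule.mul_le]
    intro a ha b hb
    exact Subalgebra.mul_mem _ (ih ha) (Algebra.subset_adjoin hb)

theorem mem_pow_of_mem_rees (M : Submodule A (Fin r → A)) (k : ℕ) (x : MvPolynomial (Fin r) A)
    (hx : x ∈ homogeneousSubmodule (Fin r) A k) (h : x ∈ reesAlg A r M) :
    x ∈ sub1 A r M ^ k := by
  have key : ∀ z ∈ ⨆ k : ℕ, sub1 A r M ^ k, homogeneousComponent k z ∈ sub1 A r M ^ k := by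
    intro z hz
    induction hz using Submodule.iSup_induction' with
    | mem j w hw =>
      rw [homogeneousComponent_of_mem (sub1_pow_le M j hw)]
      split_ifs with hkj
      · rw [hkj]; exact hw
      · exact zero_mem _
    | zero => simp
    | add a b _ _ ha hb => rw [map_add]; exact add_mem ha hb
  have := key x (adjoin_le_iSup _ x h)
  rwa [homogeneousComponent_eq_self hx] at this

theorem sub_const_mem (M : Submodule A (Fin r → A)) (z : MvPolynomial (Fin r) A)
    (h : z ∈ reesAlg A r M) :
    z - C (constantCoeff z) ∈ sub1 A r M * Subalgebra.toSubmodule (reesAlg A r M) := by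
  have hz := adjoin_le_iSup _ z h
  clear h
  induction hz using Submodule.iSup_induction' with
  | mem j w hw =>
    have hh := sub1_pow_le M j hw
    rcases j with _ | j
    · have h0 := homogeneousComponent_eq_self (n := 0) hh
      rw [homogeneousComponent_zero] at h0
      rw [constantCoeff_eq, h0, sub_self]
      exact zero_mem _
    · have h0 := homogeneousComponent_of_mem (m := 0) hh
      rw [homogeneousComponent_zero, if_neg (by omega)] at h0
      rw [constantCoeff_eq, h0, sub_zero]
      rw [pow_succ'] at hw
      exact mul_le_mul' le_rfl (pow_le_adjoin _ j) hw
  | zero => simp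
  | add a b _ _ ha hb =>
    have := add_mem ha hb
    rw [map_add, map_add]
    convert this using 1
    ring

theorem posPart_pow_mem (M : Submodule A (Fin r → A)) (m : ℕ) (y : ↥(reesAlg A r M))
    (hy : y ∈ (posPart A r (reesAlg A r M)) ^ m) :
    (y : MvPolynomial (Fin r) A)
      ∈ sub1 A r M ^ m * Subalgebra.toSubmodule (reesAlg A r M) := by
  induction m generalizing y with
  | zero => rw [pow_zero, one_mul]; exact y.2
  | succ m ih =>
    rw [pow_succ] at hy
    refine Submodule.mul_induction_on hy (fun p hp q hq => ?_) (fun a b ha hb => ?_)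
    · have h1 := ih p hp
      have h2 := sub_const_mem M q q.2
      have h3 : constantCoeff (q : MvPolynomial (Fin r) A) = 0 := hq
      rw [h3, map_zero, sub_zero] at h2
      have h4 := Submodule.mul_mem_mul h1 h2
      rw [mul_mul_mul_comm, ← pow_succ, (Subalgebra.isIdempotentElem_toSubmodule _).eq] at h4
      exact h4
    · exact add_mem ha hb

theorem mem_posPart_pow (M : Submodule A (Fin r → A)) (m : ℕ) (w : MvPolynomial (Fin r) A)
    (hw : w ∈ sub1 A r M ^ m) :
    ∃ y ∈ (posPart A r (reesAlg A r M)) ^ m, (y : MvPolynomial (Fin r) A) = w := by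
  induction m generalizing w with
  | zero => exact ⟨⟨w, pow_le_adjoin _ 0 hw⟩, by simp, rfl⟩
  | succ m ih =>
    rw [pow_succ] at hw
    refine Submodule.mul_induction_on hw (fun p hp q hq => ?_) (fun a b ha hb => ?_)
    · obtain ⟨y, hy, rfl⟩ := ih p hp
      refine ⟨y * ⟨q, Algebra.subset_adjoin hq⟩, ?_, rfl⟩
      rw [pow_succ]
      refine Ideal.mul_mem_mul hy ?_
      have h0 := homogeneousComponent_of_mem (m := 0) (freeSub_le (sub1_le_freeSub M hq))
      rw [homogeneousComponent_zero, if_neg (by omega)] at h0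
      change constantCoeff q = 0
      rw [constantCoeff_eq]
      exact C_eq_zero.mp h0
    · obtain ⟨y, hy, rfl⟩ := ha
      obtain ⟨z, hz, rfl⟩ := hb
      exact ⟨y + z, add_mem hy hz, rfl⟩

end helpers

/-- Proposition 3.4. Let `A` be a Noetherian ring and `M` a finitely
generated `A`-module contained in a free module `F` of finite rank `r > 0`. For every
`n ≥ 0`, the Ratliff--Rush closure of `M^n` (the `n`-th homogeneous component of
`widetilde{R(M)} = ε⁻¹(H⁰_{R(M)₊}(S/R(M)))`) satisfies
`widetilde{M^n} = ⋃_{ℓ>0} [(M^n)^{ℓ+1} :_{F^n} (M^n)^ℓ] = (widetilde{(MS)^n})_n`,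
where `widetilde{I} = ⋃_{ℓ≥0} [I^{ℓ+1} :_S I^ℓ]` is the ordinary Ratliff--Rush closure
of an ideal `I ⊆ S`, and `MS` is the ideal of `S` generated by `M`. In particular
(`n = 1`), `widetilde{M} = ⋃_{ℓ>0} [M^{ℓ+1} :_F M^ℓ] = (widetilde{MS})_1`. -/
theorem ratliffRush_statement_2 (A : Type) [CommRing A] [IsNoetherianRing A]
    (r : ℕ) (hr : 0 < r) (M : Submodule A (Fin r → A)) (n : ℕ) :
    ((freeSub A r) ^ n ⊓ Subalgebra.toSubmodule (rrAlg A r (reesAlg A r M))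
        = ratliffRush A r ((freeSub A r) ^ n) ((sub1 A r M) ^ n)) ∧
    (ratliffRush A r ((freeSub A r) ^ n) ((sub1 A r M) ^ n)
        = (freeSub A r) ^ n ⊓ Submodule.restrictScalars A
            (⨆ ℓ : ℕ,
              (((Ideal.span (sub1 A r M : Set (MvPolynomial (Fin r) A))) ^ n) ^ (ℓ + 1)).colon
                (((Ideal.span (sub1 A r M : Set (MvPolynomial (Fin r) A))) ^ n) ^ ℓ :
                    Ideal (MvPolynomial (Fin r) A)))) := by
  set P := sub1 A r M with hP
  rcases Nat.eq_zero_or_pos n with rfl | hn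
  · have e : ratliffRush A r ((freeSub A r) ^ 0) (P ^ 0) = (freeSub A r) ^ 0 := by
      unfold ratliffRush
      simp only [pow_zero, one_pow]
      rw [iSup_const, inf_eq_left, Submodule.le_div_iff_mul_le, one_mul]
    refine ⟨?_, ?_⟩
    · rw [e, inf_eq_left, pow_zero, Submodule.one_le]
      exact Subalgebra.one_mem _
    · rw [e, eq_comm, inf_eq_left]
      intro x _
      refine (le_iSup (fun ℓ : ℕ => (((Ideal.span (P : Set (MvPolynomial (Fin r) A))) ^ 0) ^ (ℓ + 1)).colon
                (((Ideal.span (P : Set (MvPolynomial (Fin r) A))) ^ 0) ^ ℓ :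
                    Ideal (MvPolynomial (Fin r) A))) 0) ?_
      simp
  · refine ⟨le_antisymm ?_ ?_, le_antisymm ?_ ?_⟩
    · rintro x ⟨hxF, m, hm⟩
      refine Submodule.mem_iSup_of_mem m ⟨hxF, ?_⟩
      refine Submodule.mem_div_iff_forall_mul_mem.mpr fun y hy => ?_
      rw [← pow_mul] at hy ⊢
      obtain ⟨c, hc⟩ : ∃ c, n * (m + 1) = m + c := ⟨n * (m + 1) - m, by nlinarith [Nat.sub_add_cancel (show m ≤ n * (m+1) by nlinarith)]⟩
      refine mem_pow_of_mem_rees M _ _ ?_ ?_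
      · have := IsHomogeneous.mul (freeSub_pow_le n hxF) (sub1_pow_le M _ hy)
        rw [show n * (m + 2) = n + n * (m + 1) by ring]
        exact this
      · rw [hc, pow_add] at hy
        refine Submodule.mul_induction_on hy (fun p hp q hq => ?_) (fun a b ha hb => ?_)
        · obtain ⟨p', hp', rfl⟩ := mem_posPart_pow M m p hp
          have := Subalgebra.mul_mem _ (hm p' hp') (pow_le_adjoin _ c hq)
          rwa [mul_comm (p' : MvPolynomial (Fin r) A) x, mul_assoc] at this
        · rw [mul_add]; exact add_mem ha hb
    · refine iSup_le fun ℓ => ?_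
      rintro x ⟨hxF, hx⟩
      refine ⟨hxF, n * (ℓ + 1), fun y hy => ?_⟩
      have := posPart_pow_mem M _ y hy
      refine Submodule.mul_induction_on this (fun p hp q hq => ?_) (fun a b ha hb => ?_)
      · rw [pow_mul] at hp
        have h1 := (Submodule.mem_div_iff_forall_mul_mem.mp hx) p hp
        rw [← pow_mul] at h1
        have := Subalgebra.mul_mem _ (pow_le_adjoin _ _ h1) hq
        rwa [mul_right_comm, mul_comm p x]
      · rw [add_mul]; exact add_mem ha hb
    · refine iSup_le fun ℓ => ?_
      rintro x ⟨hxF, hx⟩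
      refine ⟨hxF, ?_⟩
      refine (le_iSup (fun ℓ : ℕ => (((Ideal.span (P : Set (MvPolynomial (Fin r) A))) ^ n) ^ (ℓ + 1)).colon
                (((Ideal.span (P : Set (MvPolynomial (Fin r) A))) ^ n) ^ ℓ :
                    Ideal (MvPolynomial (Fin r) A))) (ℓ + 1)) ?_
      rw [Submodule.mem_colon]
      intro s hs
      simp only [span_pow_eq] at hs ⊢
      rw [SetLike.mem_coe] at hs
      rw [smul_eq_mul]
      induction hs using Submodule.span_induction with
      | mem w hw => exact Ideal.subset_span (hx w hw)
      | zero => simp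
      | add a b _ _ ha hb => rw [mul_add]; exact add_mem ha hb
      | smul a w _ h =>
        rw [smul_eq_mul, mul_left_comm]
        exact Ideal.mul_mem_left _ _ h
    · rintro x ⟨hxF, hx⟩
      rw [SetLike.mem_coe, Submodule.restrictScalars_mem, Submodule.mem_iSup_of_directed] at hx
      · obtain ⟨ℓ, hℓ⟩ := hx
        refine Submodule.mem_iSup_of_mem ℓ ⟨hxF, ?_⟩
        rw [Submodule.mem_colon] at hℓ
        refine Submodule.mem_div_iff_forall_mul_mem.mpr fun y hy => ?_
        rw [← pow_mul] at hy ⊢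
        refine mem_pow_of_mem_span M _ _ ?_ ?_
        · have := IsHomogeneous.mul (freeSub_pow_le n hxF) (sub1_pow_le M _ hy)
          rw [show n * (ℓ + 2) = n + n * (ℓ + 1) by ring]
          exact this
        · rw [← span_pow_eq, pow_mul, pow_succ]
          have hy' : y ∈ (Ideal.span (P : Set (MvPolynomial (Fin r) A)) ^ n) ^ (ℓ + 1) := by
            rw [← pow_mul, span_pow_eq]
            exact Ideal.subset_span hy
          rw [pow_succ] at hy'
          refine Submodule.mul_induction_on hy' (fun p hp q hq => ?_) (fun a b ha hb => ?_)
          · rw [← mul_assoc]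
            exact Ideal.mul_mem_mul (hℓ p hp) hq
          · rw [mul_add]; exact add_mem ha hb
      · refine Monotone.directed_le (monotone_nat_of_le_succ fun ℓ => ?_)
        intro z hz
        rw [Submodule.mem_colon] at hz ⊢
        intro s hs
        rw [SetLike.mem_coe, pow_succ] at hs
        rw [pow_succ]
        refine Submodule.mul_induction_on hs (fun p hp q hq => ?_) (fun a b ha hb => ?_)
        · rw [smul_eq_mul, ← mul_assoc]
          exact Ideal.mul_mem_mul (hz p hp) hq
        · rw [smul_add]; exact add_mem ha hb
end

section
/- Let A be a Noetherian ring and M a finitely generated A-module contained in a free A-module F of finite rank r > 0. If M is a faithful A-module, then tilde(M^n) ⊆ bar(M^n) ⊆ F^n for every integer n ≥ 0; consequently R(M) ⊆ widetilde(R(M)) ⊆ overline(R(M))^S ⊆ S. -/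
set_option maxHeartbeats 1000000
set_option synthInstance.maxHeartbeats 400000

open MvPolynomial IsLocalRing

namespace RRaux

open MvPolynomial

variable {A : Type} [CommRing A] {r : ℕ}

lemma emb_apply (g : Fin r → A) : emb A r g = ∑ i, C (g i) * X i := by
  simp [Fintype.linearCombination_apply, MvPolynomial.smul_eq_C_mul]

/-- McCoy-type step: if `f` kills the forms of a submodule, and `f` is support-minimal. -/
lemma annih_eq_zero (M : Submodule A (Fin r → A)) (hfaith : faithfulSub A r M) :
    ∀ (N : ℕ) (f : MvPolynomial (Fin r) A), f.support.card = N →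
      (∀ g ∈ M, f * emb A r g = 0) → f = 0 := by
  intro N
  induction N using Nat.strong_induction_on with
  | _ N IH =>
  intro f hN hf
  by_contra hne
  set c := (MonomialOrder.lex (σ := Fin r)).leadingCoeff f with hc
  set d := (MonomialOrder.lex (σ := Fin r)).degree f with hd
  have hc0 : c ≠ 0 := by
    rw [hc, Ne, MonomialOrder.leadingCoeff_eq_zero_iff]; exact hne
  have hcd : c = coeff d f := rfl
  have key : ∀ g ∈ M, ∀ i : Fin r, g i * c = 0 := by
    intro g hg
    have : ∀ n : ℕ, ∀ i : Fin r, i.val = n → g i * c = 0 ∧ C (g i) * f = 0 := by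
      intro n
      induction n using Nat.strong_induction_on with
      | _ n ih =>
      intro i hi
      have h1 : g i * c = 0 := by
        have h0 := congrArg (coeff (d + Finsupp.single i 1)) (hf g hg)
        rw [emb_apply, Finset.mul_sum, coeff_sum, coeff_zero,
          Finset.sum_eq_single i] at h0
        · rw [show f * (C (g i) * X i) = C (g i) * (f * X i) by ring, coeff_C_mul,
            coeff_mul_X] at h0
          exact h0
        · intro j _ hji
          rcases lt_or_gt_of_ne hji with h | h
          · rw [show f * (C (g j) * X j) = C (g j) * f * X j by ring,
              (ih j.val (by omega) j rfl).2]
            simp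
          · rw [show f * (C (g j) * X j) = C (g j) * (f * X j) by ring, coeff_C_mul,
              coeff_mul_X']
            split_ifs with hs
            · rw [MonomialOrder.coeff_eq_zero_of_lt (m := MonomialOrder.lex), mul_zero]
              have e : (d + Finsupp.single i 1 - Finsupp.single j 1) + Finsupp.single j 1
                  = d + Finsupp.single i 1 := by
                apply tsub_add_cancel_of_le
                rw [Finsupp.single_le_iff]
                exact Nat.one_le_iff_ne_zero.mpr (Finsupp.mem_support_iff.mp hs)
              have e2 := congrArg (MonomialOrder.lex (σ := Fin r)).toSyn e
              rw [map_add, map_add] at e2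
              have e3 : (MonomialOrder.lex (σ := Fin r)).toSyn (Finsupp.single j 1) <
                  (MonomialOrder.lex (σ := Fin r)).toSyn (Finsupp.single i 1) := by
                rw [MonomialOrder.lex_lt_iff, Finsupp.Lex.single_lt_iff]; exact h
              by_contra hcon
              rw [not_lt] at hcon
              exact absurd e2 (ne_of_lt (add_lt_add_of_le_of_lt hcon e3))
            · simp
        · simp
      refine ⟨h1, ?_⟩
      refine IH _ ?_ (C (g i) * f) rfl ?_
      · rw [← hN]
        apply Finset.card_lt_card
        rw [Finset.ssubset_iff_of_subset]
        · refine ⟨d, ?_, ?_⟩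
          · rw [mem_support_iff]; exact hc0
          · rw [mem_support_iff, coeff_C_mul, not_not]; exact h1
        · intro e he
          rw [mem_support_iff, coeff_C_mul] at he
          rw [mem_support_iff]
          exact right_ne_zero_of_mul he
      · intro g' hg'
        rw [mul_assoc, hf g' hg', mul_zero]
    intro i
    exact (this i.val i rfl).1
  apply hc0
  apply hfaith
  intro g hg
  ext i
  simpa [mul_comm] using key g hg i

lemma annih_pow (M : Submodule A (Fin r → A)) (hfaith : faithfulSub A r M) (m : ℕ) :
    ∀ f : MvPolynomial (Fin r) A, (∀ y ∈ (sub1 A r M) ^ m, f * y = 0) → f = 0 := by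
  induction m with
  | zero =>
    intro f hf
    simpa using hf 1 (by rw [pow_zero]; exact Submodule.one_le.mp le_rfl)
  | succ m ih =>
    intro f hf
    apply ih
    intro y hy
    refine annih_eq_zero M hfaith _ _ rfl ?_
    intro g hg
    rw [mul_assoc]
    apply hf
    rw [pow_succ]
    exact Submodule.mul_mem_mul hy (Submodule.mem_map_of_mem hg)

lemma pow_le_rees (M : Submodule A (Fin r → A)) (m : ℕ) :
    (sub1 A r M) ^ m ≤ Subalgebra.toSubmodule (reesAlg A r M) := by
  intro y hy
  induction hy using Submodule.pow_induction_on_left' with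
  | algebraMap a => exact (reesAlg A r M).algebraMap_mem a
  | add x y i hx hy h1 h2 => exact add_mem h1 h2
  | mem_mul z hz i x hx h => exact (reesAlg A r M).mul_mem (Algebra.subset_adjoin hz) h

/-- The `R(M)`-submodule of `S` generated by `M^m`. -/
noncomputable def J (M : Submodule A (Fin r → A)) (m : ℕ) :
    Submodule (reesAlg A r M) (MvPolynomial (Fin r) A) :=
  Submodule.span _ ((sub1 A r M ^ m : Submodule A (MvPolynomial (Fin r) A)) :
    Set (MvPolynomial (Fin r) A))

lemma J_fg [IsNoetherianRing A] (M : Submodule A (Fin r → A)) (m : ℕ) : (J M m).FG := by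
  have h : (sub1 A r M ^ m).FG :=
    Submodule.FG.pow (Submodule.FG.map _ (IsNoetherian.noetherian M)) m
  obtain ⟨T, hT⟩ := h
  refine ⟨T, ?_⟩
  rw [J, ← hT, Submodule.span_span_of_tower]

lemma integral_of_stab [IsNoetherianRing A] (M : Submodule A (Fin r → A))
    (hfaith : faithfulSub A r M) (m : ℕ) (x : MvPolynomial (Fin r) A)
    (hx : ∀ y ∈ (sub1 A r M) ^ m, x * y ∈ J M m) : x ∈ intClAlg A r M := by
  change IsIntegral (reesAlg A r M) x
  have hx' : ∀ y ∈ J M m, LinearMap.mulLeft (reesAlg A r M) x y ∈ J M m := by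
    intro y hy
    have : J M m ≤ (J M m).comap (LinearMap.mulLeft (reesAlg A r M) x) := by
      conv_lhs => rw [J]
      rw [Submodule.span_le]
      exact fun y hy => hx y hy
    exact this hy
  have : Module.Finite (reesAlg A r M) (J M m) := Module.Finite.iff_fg.mpr (J_fg M m)
  obtain ⟨p, hp, hp0⟩ := LinearMap.exists_monic_and_aeval_eq_zero (M := J M m) (reesAlg A r M)
    ((LinearMap.mulLeft (reesAlg A r M) x).restrict hx')
  refine ⟨p, hp, ?_⟩
  change Polynomial.aeval x p = 0
  apply annih_pow M hfaith m
  intro y hy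
  have hyJ : y ∈ J M m := Submodule.subset_span hy
  have key : ∀ q : Polynomial (reesAlg A r M), ∀ y : J M m,
      ((Polynomial.aeval ((LinearMap.mulLeft (reesAlg A r M) x).restrict hx') q y : J M m) :
        MvPolynomial (Fin r) A) = Polynomial.aeval x q * (y : MvPolynomial (Fin r) A) := by
    intro q
    induction q using Polynomial.induction_on' with
    | add p q hp hq => intro y; simp [hp, hq, add_mul]
    | monomial n a =>
      induction n with
      | zero =>
        intro y
        simp [Polynomial.aeval_monomial, Module.algebraMap_end_apply, Algebra.smul_def]
      | succ n ih =>
        intro y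
        have := ih (((LinearMap.mulLeft (reesAlg A r M) x).restrict hx') y)
        rw [Polynomial.aeval_monomial] at this ⊢
        rw [pow_succ, ← mul_assoc, Module.End.mul_apply, this, Polynomial.aeval_monomial,
          Polynomial.aeval_monomial]
        simp only [LinearMap.restrict_coe_apply, LinearMap.mulLeft_apply]
        ring
  have := key p ⟨y, hyJ⟩
  rw [hp0] at this
  simpa using this.symm

lemma pow_homog (M : Submodule A (Fin r → A)) (m : ℕ) :
    (sub1 A r M) ^ m ≤ homogeneousSubmodule (Fin r) A m := by
  intro y hy
  induction hy using Submodule.pow_induction_on_left' with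
  | algebraMap a => exact isHomogeneous_C _ a
  | add x y i hx hy h1 h2 => exact add_mem h1 h2
  | mem_mul z hz i x hx h =>
    obtain ⟨g, hg, rfl⟩ := hz
    have h1 : (emb A r g).IsHomogeneous 1 := by
      rw [emb_apply]
      apply IsHomogeneous.sum
      intro i _
      simpa using (isHomogeneous_C (Fin r) (g i)).mul (isHomogeneous_X A i)
    have := h1.mul h
    rw [add_comm] at this
    exact this

lemma comp_mem (M : Submodule A (Fin r → A)) (z : MvPolynomial (Fin r) A)
    (hz : z ∈ reesAlg A r M) (k : ℕ) :
    homogeneousComponent k z ∈ (sub1 A r M) ^ k := by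
  have hz' : z ∈ Subalgebra.toSubmodule (reesAlg A r M) := hz
  rw [Algebra.adjoin_eq_span] at hz'
  have hle : Submodule.span A ((Submonoid.closure (sub1 A r M : Set (MvPolynomial (Fin r) A)) :
      Submonoid _) : Set (MvPolynomial (Fin r) A)) ≤
      ((sub1 A r M) ^ k).comap (homogeneousComponent k) := by
    rw [Submodule.span_le]
    intro w hw
    have : ∃ n, w ∈ (sub1 A r M) ^ n := by
      induction hw using Submonoid.closure_induction with
      | mem x hx => exact ⟨1, by simpa using hx⟩
      | one => exact ⟨0, by rw [pow_zero]; exact Submodule.one_le.mp le_rfl⟩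
      | mul x y _ _ h1 h2 =>
        obtain ⟨a, ha⟩ := h1
        obtain ⟨b, hb⟩ := h2
        exact ⟨a + b, by rw [pow_add]; exact Submodule.mul_mem_mul ha hb⟩
    obtain ⟨n, hn⟩ := this
    change homogeneousComponent k w ∈ sub1 A r M ^ k
    rw [homogeneousComponent_of_mem (pow_homog M n hn)]
    split_ifs with h
    · rw [h]; exact hn
    · exact zero_mem _
  exact hle hz'

lemma pow_mem_J (M : Submodule A (Fin r → A)) (m k : ℕ) (hk : m ≤ k)
    (z : MvPolynomial (Fin r) A) (hz : z ∈ (sub1 A r M) ^ k) : z ∈ J M m := by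
  obtain ⟨j, rfl⟩ := Nat.exists_eq_add_of_le' hk
  rw [pow_add] at hz
  refine Submodule.mul_induction_on hz ?_ (fun _ _ h1 h2 => (J M m).add_mem h1 h2)
  intro a ha b hb
  exact (J M m).smul_mem (⟨a, pow_le_rees M j ha⟩ : reesAlg A r M) (Submodule.subset_span hb)

lemma mul_mem_J (M : Submodule A (Fin r → A)) (m : ℕ) (x y : MvPolynomial (Fin r) A)
    (hy : y ∈ (sub1 A r M) ^ m) (hxy : x * y ∈ reesAlg A r M) : x * y ∈ J M m := by
  rw [← sum_homogeneousComponent (x * y)]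
  refine sum_mem fun k _ => ?_
  rcases le_or_gt m k with h | h
  · exact pow_mem_J M m k h _ (comp_mem M _ hxy k)
  · have : homogeneousComponent k (x * y) = 0 := by
      ext d
      rw [coeff_homogeneousComponent, coeff_zero]
      split_ifs with hd
      · classical
        rw [coeff_mul]
        apply Finset.sum_eq_zero
        rintro ⟨a, b⟩ hab
        rw [Finset.HasAntidiagonal.mem_antidiagonal] at hab
        have hh : IsHomogeneous y m := pow_homog M m hy
        rw [hh.coeff_eq_zero, mul_zero]
        have h3 := congrArg Finsupp.degree hab
        simp only [map_add] at h3
        simp only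
        omega
      · rfl
    rw [this]; exact zero_mem _

lemma pow_mem_posPart (M : Submodule A (Fin r → A)) (m : ℕ) (y : MvPolynomial (Fin r) A)
    (hy : y ∈ (sub1 A r M) ^ m) :
    ∃ p ∈ (posPart A r (reesAlg A r M)) ^ m, (p : MvPolynomial (Fin r) A) = y := by
  induction hy using Submodule.pow_induction_on_left' with
  | algebraMap a =>
    exact ⟨algebraMap A _ a, by simp, rfl⟩
  | add x y i hx hy h1 h2 =>
    obtain ⟨p, hp, rfl⟩ := h1
    obtain ⟨q, hq, rfl⟩ := h2
    exact ⟨p + q, add_mem hp hq, rfl⟩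
  | mem_mul z hz i x hx h =>
    obtain ⟨p, hp, rfl⟩ := h
    have hz' : z ∈ reesAlg A r M := Algebra.subset_adjoin hz
    refine ⟨⟨z, hz'⟩ * p, ?_, rfl⟩
    rw [pow_succ']
    refine Ideal.mul_mem_mul ?_ hp
    obtain ⟨g, hg, rfl⟩ := hz
    change constantCoeff (emb A r g) = 0
    rw [emb_apply]
    simp

end RRaux

/-- Corollary 3.5. Let `A` be a Noetherian ring and `M` a finitely
generated `A`-module contained in a free module `F` of finite rank `r > 0`. If `M` is a
faithful `A`-module, then `widetilde{M^n} ⊆ overline{M^n} ⊆ F^n` for every `n ≥ 0`;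
consequently `R(M) ⊆ widetilde{R(M)} ⊆ overline{R(M)}^S ⊆ S`. -/
theorem ratliffRush_statement_3 (A : Type) [CommRing A] [IsNoetherianRing A]
    (r : ℕ) (hr : 0 < r) (M : Submodule A (Fin r → A))
    (hfaith : faithfulSub A r M) :
    (∀ n : ℕ,
      ratliffRush A r ((freeSub A r) ^ n) ((sub1 A r M) ^ n) ≤ barPow A r M n ∧
      barPow A r M n ≤ (freeSub A r) ^ n) ∧
    reesAlg A r M ≤ rrAlg A r (reesAlg A r M) ∧
    rrAlg A r (reesAlg A r M) ≤ intClAlg A r M := by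
  have hrees : ∀ m (x : MvPolynomial (Fin r) A),
      (∀ y ∈ (sub1 A r M) ^ m, x * y ∈ RRaux.J M m) → x ∈ intClAlg A r M :=
    fun m x hx => RRaux.integral_of_stab M hfaith m x hx
  refine ⟨fun n => ⟨?_, inf_le_left⟩, ?_, ?_⟩
  · refine iSup_le fun l => ?_
    rintro x ⟨hxF, hx⟩
    refine ⟨hxF, hrees (n * (l + 1)) x fun y hy => ?_⟩
    rw [pow_mul] at hy
    have := Submodule.mem_div_iff_forall_mul_mem.mp hx y hy
    rw [← pow_mul] at this
    exact RRaux.pow_mem_J M _ _ (Nat.mul_le_mul_left n (by omega)) _ this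
  · intro x hx
    exact ⟨0, fun y _ => mul_mem y.2 hx⟩
  · rintro x ⟨m, hm⟩
    refine hrees m x fun y hy => RRaux.mul_mem_J M m x y hy ?_
    obtain ⟨p, hp, rfl⟩ := RRaux.pow_mem_posPart M m y hy
    rw [mul_comm]
    exact hm p hp
end
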